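/- arXiv:1901.04470 — 6 statements merged into one kernel-verified Lean document; each statement's English description precedes it below -/
import Mathlib

section
/- Let g be an odd prime and let D be a division ring, finite-dimensional as a ℚ-algebra, whose center K is a totally imaginary quadratic number field and such that D has degree g over K (i.e., dim_K D = g²). If G is a finite group of even order that admits an injective group homomorphism into the unit group D^×, then G is cyclic, and moreover: if g = 3 then |G| ∈ {2, 4, 6, 14, 18}; if g ≥ 5 and 2g+1 is a prime number then |G| ∈ {2, 4, 6, 4g+2}; if g ≥ 5 and 2g+1 is not a prime number then |G| ∈ {2, 4, 6}. -/
open scoped IsMulCommutative commutatorElement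

theorem Subalgebra.finrank_dvd_finrank_of_le {F D : Type*} [Field F] [DivisionRing D] [Algebra F D]
    [FiniteDimensional F D] {A B : Subalgebra F D} (h : A ≤ B) :
    Module.finrank F A ∣ Module.finrank F B := by
  let _ : DivisionRing A := divisionRingOfFiniteDimensional F A
  let _ : Module A B := Module.compHom B (Subalgebra.inclusion h).toRingHom
  have : IsScalarTower F A B :=
    ⟨fun r a b => Subtype.ext (by
      change (r • (a : D)) * (b : D) = r • ((a : D) * (b : D))
      exact smul_mul_assoc _ _ _)⟩
  exact ⟨_, (Module.finrank_mul_finrank F A B).symm⟩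

theorem IsPrimitiveRoot.finrank_algebraAdjoin {E : Type*} [Field E] [Algebra ℚ E]
    {n : ℕ} (hn : 0 < n) {x : E} (hx : IsPrimitiveRoot x n) :
    Module.finrank ℚ (Algebra.adjoin ℚ {x}) = n.totient := by
  have hint : IsIntegral ℚ x := (hx.isIntegral hn).tower_top
  have : CharZero E := algebraRat.charZero E
  have : NeZero (n : ℚ) := ⟨Nat.cast_ne_zero.2 hn.ne'⟩
  rw [← Polynomial.natDegree_cyclotomic n ℚ,
    hx.minpoly_eq_cyclotomic_of_irreducible (Polynomial.cyclotomic.irreducible_rat hn),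
    ← IntermediateField.adjoin.finrank hint,
    ← IntermediateField.adjoin_simple_toSubalgebra_of_isAlgebraic hint.isAlgebraic]
  rfl

theorem Subalgebra.totient_orderOf_dvd_finrank {D : Type*} [DivisionRing D] [Algebra ℚ D]
    [FiniteDimensional ℚ D] (E : Subalgebra ℚ D) [IsMulCommutative E] {x : D} (hxE : x ∈ E)
    (hx : 0 < orderOf x) : (orderOf x).totient ∣ Module.finrank ℚ E := by
  let _ : Field E := fieldOfFiniteDimensional ℚ E
  have hx' : orderOf (⟨x, hxE⟩ : E) = orderOf x :=
    (orderOf_injective E.val.toRingHom.toMonoidHom Subtype.val_injective ⟨x, hxE⟩).symm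
  rw [← hx', ← (IsPrimitiveRoot.orderOf (⟨x, hxE⟩ : E)).finrank_algebraAdjoin (hx'.symm ▸ hx)]
  have h := Subalgebra.finrank_dvd_finrank_of_le
    (le_top : Algebra.adjoin ℚ {(⟨x, hxE⟩ : E)} ≤ ⊤)
  rwa [subalgebra_top_finrank_eq_submodule_top_finrank, finrank_top] at h

theorem isMulCommutative_adjoin_center_union {F D : Type*} [Field F] [DivisionRing D] [Algebra F D]
    {s : Set D} (hs : ∀ x ∈ s, ∀ y ∈ s, x * y = y * x) :
    IsMulCommutative (Algebra.adjoin F ((Subalgebra.center F D : Set D) ∪ s)) := by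
  refine Algebra.isMulCommutative_adjoin F ?_
  rintro x (hx | hx) y (hy | hy)
  · exact (Subalgebra.mem_center_iff.1 hx y).symm
  · exact (Subalgebra.mem_center_iff.1 hx y).symm
  · exact Subalgebra.mem_center_iff.1 hy x
  · exact hs x hx y hy

section

variable {g : ℕ} {D : Type*} [DivisionRing D] [Algebra ℚ D] [FiniteDimensional ℚ D]

theorem finrank_rat_of_finrank_center
    (hK2 : Module.finrank ℚ (Subalgebra.center ℚ D) = 2)
    (hdeg : Module.finrank (Subalgebra.center ℚ D) D = g ^ 2) :
    Module.finrank ℚ D = 2 * g ^ 2 := by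
  let _ : Field (Subalgebra.center ℚ D) := fieldOfFiniteDimensional ℚ _
  have := Module.finrank_mul_finrank ℚ (Subalgebra.center ℚ D) D
  rw [← this, hK2, hdeg]

theorem finrank_of_isMulCommutative (hg : g.Prime)
    (hK2 : Module.finrank ℚ (Subalgebra.center ℚ D) = 2) (hD : Module.finrank ℚ D = 2 * g ^ 2)
    (E : Subalgebra ℚ D) [IsMulCommutative E] (hE : Subalgebra.center ℚ D ≤ E) :
    Module.finrank ℚ E = 2 ∨ Module.finrank ℚ E = 2 * g := by
  have h1 := Subalgebra.finrank_dvd_finrank_of_le hE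
  have h2 := Subalgebra.finrank_dvd_finrank_of_le (le_top : E ≤ ⊤)
  rw [hK2] at h1
  rw [subalgebra_top_finrank_eq_submodule_top_finrank, finrank_top, hD] at h2
  obtain ⟨k, hk⟩ := h1
  rw [hk] at h2 ⊢
  have h3 : k ∣ g ^ 2 := Nat.dvd_of_mul_dvd_mul_left two_pos h2
  obtain ⟨i, hi, rfl⟩ := (Nat.dvd_prime_pow hg).1 h3
  interval_cases i
  · simp
  · simp
  · exfalso
    have hE' : E = ⊤ := Subalgebra.eq_of_le_of_finrank_eq le_top (by
      rw [hk, subalgebra_top_finrank_eq_submodule_top_finrank, finrank_top, hD])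
    have hc : Subalgebra.center ℚ D = ⊤ := by
      rw [eq_top_iff]
      intro x _
      refine Subalgebra.mem_center_iff.2 fun y => ?_
      exact setLike_mul_comm (s := E) (by simp [hE']) (by simp [hE'])
    rw [hc, subalgebra_top_finrank_eq_submodule_top_finrank, finrank_top, hD] at hK2
    have := hg.two_le
    nlinarith

theorem totient_orderOf_dvd (hg : g.Prime)
    (hK2 : Module.finrank ℚ (Subalgebra.center ℚ D) = 2) (hD : Module.finrank ℚ D = 2 * g ^ 2)
    {x : D} (hx : 0 < orderOf x) :
    (orderOf x).totient ∣ 2 * g := by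
  have := isMulCommutative_adjoin_center_union (F := ℚ) (s := {x}) (by simp)
  set E := Algebra.adjoin ℚ ((Subalgebra.center ℚ D : Set D) ∪ {x})
  have h1 := E.totient_orderOf_dvd_finrank (x := x) (Algebra.subset_adjoin (Or.inr rfl)) hx
  rcases finrank_of_isMulCommutative hg hK2 hD E
    (fun z hz => Algebra.subset_adjoin (Or.inl hz)) with h | h
  · exact (h ▸ h1).trans (dvd_mul_right _ _)
  · exact h ▸ h1

theorem mem_center_of_totient_le_two (hg : g.Prime) (hodd : Odd g)
    (hK2 : Module.finrank ℚ (Subalgebra.center ℚ D) = 2) (hD : Module.finrank ℚ D = 2 * g ^ 2)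
    {x : D} (hx : 0 < orderOf x) (hx2 : (orderOf x).totient ≤ 2) :
    x ∈ Subalgebra.center ℚ D := by
  have := isMulCommutative_adjoin_center_union (F := ℚ) (s := {x}) (by simp)
  set E := Algebra.adjoin ℚ ((Subalgebra.center ℚ D : Set D) ∪ {x}) with hE
  let _ : Field E := fieldOfFiniteDimensional ℚ E
  have hZE : Subalgebra.center ℚ D ≤ E := fun z hz => Algebra.subset_adjoin (Or.inl hz)
  have hxE : x ∈ E := Algebra.subset_adjoin (Or.inr rfl)
  let x' : E := ⟨x, hxE⟩
  have hx' : orderOf x' = orderOf x :=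
    (orderOf_injective E.val.toRingHom.toMonoidHom Subtype.val_injective x').symm
  have h1 := (IsPrimitiveRoot.orderOf x').finrank_algebraAdjoin (hx'.symm ▸ hx)
  set A := (Subalgebra.inclusion hZE).range
  set B := Algebra.adjoin ℚ {x'}
  have h2 := A.finrank_sup_le_of_free B
  have h3 : Module.finrank ℚ A = 2 := by
    rw [← hK2]
    exact (AlgEquiv.ofInjective _
      (Subalgebra.inclusion_injective hZE)).toLinearEquiv.finrank_eq.symm
  have h4 : A ⊔ B = ⊤ := by
    have hle : E ≤ (A ⊔ B).map E.val := by
      refine Algebra.adjoin_le ?_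
      rintro z (hz | rfl)
      · exact ⟨⟨z, hZE hz⟩, le_sup_left (a := A) ⟨⟨z, hz⟩, rfl⟩, rfl⟩
      · exact ⟨x', le_sup_right (b := B) (Algebra.subset_adjoin rfl), rfl⟩
    rw [eq_top_iff]
    rintro z -
    obtain ⟨w, hw, hwz⟩ := hle z.2
    rwa [← (Subtype.ext hwz : w = z)]
  rw [h4, h3, h1, hx', subalgebra_top_finrank_eq_submodule_top_finrank, finrank_top] at h2
  rcases finrank_of_isMulCommutative hg hK2 hD E hZE with h | h
  · rw [Subalgebra.eq_of_le_of_finrank_eq hZE (by rw [hK2, h])]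
    exact hxE
  · have := hg.two_le
    obtain ⟨k, rfl⟩ := hodd
    omega

theorem mul_comm_of_commute_of_notMem_center (hg : g.Prime)
    (hK2 : Module.finrank ℚ (Subalgebra.center ℚ D) = 2) (hD : Module.finrank ℚ D = 2 * g ^ 2)
    {c x y : D} (hc : c ∉ Subalgebra.center ℚ D) (hx : c * x = x * c) (hy : c * y = y * c) :
    x * y = y * x := by
  have := isMulCommutative_adjoin_center_union (F := ℚ) (s := {c}) (by simp)
  have := isMulCommutative_adjoin_center_union (F := ℚ) (s := {c, x}) (by simp [hx])
  set E := Algebra.adjoin ℚ ((Subalgebra.center ℚ D : Set D) ∪ {c})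
  set L := Algebra.adjoin ℚ ((Subalgebra.center ℚ D : Set D) ∪ {c, x})
  have hZE : Subalgebra.center ℚ D ≤ E := fun z hz => Algebra.subset_adjoin (Or.inl hz)
  have hEL : E ≤ L := Algebra.adjoin_mono (Set.union_subset_union_right _ (by simp))
  have hE : Module.finrank ℚ E = 2 * g := by
    refine (finrank_of_isMulCommutative hg hK2 hD E hZE).resolve_left fun h => hc ?_
    rw [Subalgebra.eq_of_le_of_finrank_eq hZE (by rw [hK2, h])]
    exact Algebra.subset_adjoin (by simp)
  have hL : Module.finrank ℚ L = 2 * g := by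
    refine (finrank_of_isMulCommutative hg hK2 hD L (hZE.trans hEL)).resolve_left fun h => ?_
    have := Submodule.finrank_mono (R := ℚ) (s := E.toSubmodule) (t := L.toSubmodule) hEL
    change Module.finrank ℚ E ≤ Module.finrank ℚ L at this
    have := hg.two_le
    omega
  have hxE : x ∈ E := by
    rw [Subalgebra.eq_of_le_of_finrank_eq hEL (by rw [hE, hL])]
    exact Algebra.subset_adjoin (by simp)
  have hEy : E ≤ Subalgebra.centralizer ℚ {y} := by
    refine Algebra.adjoin_le ?_
    rintro z (hz | hz)
    · exact Subalgebra.mem_centralizer_iff ℚ |>.2 fun w _ => Subalgebra.mem_center_iff.1 hz w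
    · rw [Set.mem_singleton_iff.1 hz]
      exact (Subalgebra.mem_centralizer_iff ℚ).2 (by simp [hy])
  exact ((Subalgebra.mem_centralizer_iff ℚ).1 (hEy hxE) y rfl).symm

end

theorem isCyclic_of_injective_of_forall_mul_comm {D G : Type*} [DivisionRing D] [Group G] [Finite G]
    (hG : ∀ x y : G, x * y = y * x) (φ : G →* Dˣ) (hφ : Function.Injective φ) : IsCyclic G := by
  have := Algebra.isMulCommutative_adjoin ℤ (A := D) (s := Set.range fun x => (φ x : D)) (by
    rintro _ ⟨x, rfl⟩ _ ⟨y, rfl⟩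
    simp only [← Units.val_mul, ← map_mul, hG x y])
  let f : G →* Algebra.adjoin ℤ (Set.range fun x => (φ x : D)) :=
    { toFun x := ⟨φ x, Algebra.subset_adjoin ⟨x, rfl⟩⟩
      map_one' := by ext; simp
      map_mul' x y := by ext; simp }
  refine isCyclic_of_injective_ringHom f fun x y h => hφ (Units.ext ?_)
  exact congrArg Subtype.val h

theorem Nat.eq_of_totient_eq_two_mul_odd {m n : ℕ} (hm : Odd m) (h : n.totient = 2 * m) :
    n = 4 ∨ ∃ p k, p.Prime ∧ p ≠ 2 ∧ (n = p ^ (k + 1) ∨ n = 2 * p ^ (k + 1)) ∧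
      p ^ k * (p - 1) = 2 * m := by
  have hn : n ≠ 0 := by
    rintro rfl
    obtain ⟨l, rfl⟩ := hm
    simp at h
  by_cases hp : ∃ p, p.Prime ∧ p ∣ n ∧ p ≠ 2
  · right
    obtain ⟨p, hp, hpn, hp2⟩ := hp
    obtain ⟨k, r, hr, hkr⟩ := Nat.exists_eq_pow_mul_and_not_dvd hn p hp.ne_one
    obtain _ | k := k
    · exact absurd hpn (by simpa [hkr] using hr)
    have hcop : (p ^ (k + 1)).Coprime r := ((hp.coprime_iff_not_dvd).2 hr).pow_left _
    rw [hkr, Nat.totient_mul hcop, Nat.totient_prime_pow_succ hp] at h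
    obtain ⟨t, ht⟩ := hp.even_sub_one hp2
    have hr2 : r ≤ 2 := by
      by_contra! hlt
      obtain ⟨s, hs⟩ := Nat.totient_even hlt
      obtain ⟨l, rfl⟩ := hm
      rw [ht, hs] at h
      have : 2 * (p ^ k * t * s) = 2 * l + 1 := by nlinarith
      omega
    have hr0 : r ≠ 0 := by rintro rfl; simp at hr
    refine ⟨p, k, hp, hp2, ?_⟩
    interval_cases r
    · exact absurd rfl hr0
    · exact ⟨Or.inl (by simpa using hkr), by simpa using h⟩
    · exact ⟨Or.inr (by rw [hkr, mul_comm]), by simpa using h⟩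
  · left
    push Not at hp
    have hpow := Nat.eq_prime_pow_of_unique_prime_dvd hn fun {d} hd hdn => hp d hd hdn
    set k := n.primeFactorsList.length
    rw [hpow] at h ⊢
    obtain ⟨l, rfl⟩ := hm
    obtain _ | _ | _ | k := k
    · simp at h; omega
    · simp at h; omega
    · rfl
    · rw [Nat.totient_prime_pow_succ Nat.prime_two, pow_succ, pow_succ] at h
      omega

theorem Nat.eq_of_totient_eq_two {n : ℕ} (h : n.totient = 2) : n = 3 ∨ n = 4 ∨ n = 6 := by
  obtain h | ⟨p, k, hp, hp2, hn, h⟩ :=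
    Nat.eq_of_totient_eq_two_mul_odd odd_one (h.trans (by norm_num))
  · simp [h]
  have h2 := hp.two_le
  have h3 : p - 1 ≤ p ^ k * (p - 1) := Nat.le_mul_of_pos_left _ (pow_pos hp.pos _)
  obtain rfl : p = 3 := by omega
  obtain rfl : k = 0 := by
    by_contra hk
    have := Nat.one_lt_pow hk (by norm_num : 1 < 3)
    omega
  simpa using hn.elim Or.inl (fun h => Or.inr (Or.inr h))

theorem Nat.eq_of_totient_eq_two_mul_prime {g n : ℕ} (hg : g.Prime) (hodd : Odd g)
    (h : n.totient = 2 * g) :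
    ((2 * g + 1).Prime ∧ (n = 2 * g + 1 ∨ n = 2 * (2 * g + 1))) ∨
      (g = 3 ∧ (n = 9 ∨ n = 18)) := by
  have hg2 := hg.two_le
  obtain h | ⟨p, k, hp, hp2, hn, hpk⟩ := Nat.eq_of_totient_eq_two_mul_odd hodd h
  · subst h
    obtain ⟨l, rfl⟩ := hodd
    have : Nat.totient 4 = 2 := by decide
    omega
  have h2 := hp.two_le
  obtain _ | k := k
  · left
    obtain rfl : p = 2 * g + 1 := by simp at hpk; omega
    exact ⟨hp, by simpa using hn⟩
  · right
    have hpg : p = g := by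
      have : p ∣ 2 * g := hpk ▸ (dvd_pow_self p k.succ_ne_zero).mul_right _
      rcases hp.dvd_mul.1 this with h | h
      · exact absurd ((Nat.prime_dvd_prime_iff_eq hp Nat.prime_two).1 h) hp2
      · exact (Nat.prime_dvd_prime_iff_eq hp hg).1 h
    subst hpg
    have h3 : p ^ k * (p - 1) = 2 := by
      have : p * (p ^ k * (p - 1)) = p * 2 := by rw [mul_comm p 2, ← hpk]; ring
      exact Nat.eq_of_mul_eq_mul_left hp.pos this
    have h4 : p - 1 ≤ p ^ k * (p - 1) := Nat.le_mul_of_pos_left _ (pow_pos hp.pos _)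
    obtain rfl : p = 3 := by omega
    obtain rfl : k = 0 := by
      by_contra hk
      have := Nat.one_lt_pow hk (by norm_num : 1 < 3)
      omega
    simpa using hn

theorem Nat.totient_le_two_or_of_dvd_two_mul_prime {g n : ℕ} (hg : g.Prime) (hodd : Odd g)
    (h : n.totient ∣ 2 * g) :
    n.totient ≤ 2 ∨ ((2 * g + 1).Prime ∧ (n = 2 * g + 1 ∨ n = 2 * (2 * g + 1))) ∨
      (g = 3 ∧ (n = 9 ∨ n = 18)) := by
  rw [or_iff_not_imp_left]
  intro hlt
  refine Nat.eq_of_totient_eq_two_mul_prime hg hodd ?_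
  have hn : 2 < n := by
    by_contra! hn
    exact hlt ((Nat.totient_le n).trans hn)
  obtain ⟨t, ht⟩ := Nat.totient_even hn
  have htg : t ∣ g := by
    rw [ht, ← two_mul] at h
    exact Nat.dvd_of_mul_dvd_mul_left two_pos h
  rcases (Nat.dvd_prime hg).1 htg with rfl | rfl <;> omega

theorem Nat.totient_le_two_of_dvd_six {n : ℕ} (h : n ∣ 6) : n.totient ≤ 2 := by
  have hn : n ≤ 6 := Nat.le_of_dvd (by norm_num) h
  interval_cases n <;> first | decide | omega

theorem exists_commutator_mem_center_of_pow_mem_center {G : Type*} [Group G] [Finite G] {q : ℕ}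
    [Fact q.Prime] (hq : ∀ x : G, x ^ q ∈ Subgroup.center G) {a b : G} (hab : a * b ≠ b * a) :
    ∃ x y : G, x * y ≠ y * x ∧ ⁅x, y⁆ ∈ Subgroup.center G := by
  have hP : IsPGroup q (G ⧸ Subgroup.center G) := by
    intro x
    obtain ⟨x, rfl⟩ := QuotientGroup.mk_surjective x
    exact ⟨1, by rw [pow_one, ← QuotientGroup.mk_pow, QuotientGroup.eq_one_iff]; exact hq x⟩
  have : Nontrivial (G ⧸ Subgroup.center G) := by
    refine ⟨⟨a, 1, fun h => hab ?_⟩⟩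
    rw [QuotientGroup.eq_one_iff, Subgroup.mem_center_iff] at h
    exact (h b).symm
  have := hP.center_nontrivial
  obtain ⟨⟨z, hz⟩, hz1⟩ := exists_ne (1 : Subgroup.center (G ⧸ Subgroup.center G))
  obtain ⟨x, rfl⟩ := QuotientGroup.mk_surjective z
  have hx : x ∉ Subgroup.center G := fun h =>
    hz1 (Subtype.ext ((QuotientGroup.eq_one_iff x).2 h))
  rw [Subgroup.mem_center_iff] at hx
  push Not at hx
  obtain ⟨y, hy⟩ := hx
  refine ⟨x, y, hy.symm, ?_⟩
  rw [← QuotientGroup.eq_one_iff]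
  have := Subgroup.mem_center_iff.1 hz y
  rw [commutatorElement_def, QuotientGroup.mk_mul, QuotientGroup.mk_mul, QuotientGroup.mk_mul,
    ← this]
  simp

theorem commutator_pow_eq_one_of_pow_mem_center {G : Type*} [Group G] {x y : G} {n : ℕ}
    (hc : ⁅x, y⁆ ∈ Subgroup.center G) (hx : x ^ n ∈ Subgroup.center G) : ⁅x, y⁆ ^ n = 1 := by
  have h1 : x = ⁅x, y⁆ * (y * x * y⁻¹) := by rw [commutatorElement_def]; group
  have h2 : Commute ⁅x, y⁆ (y * x * y⁻¹) := (Subgroup.mem_center_iff.1 hc _).symm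
  have h3 := congrArg (· ^ n) h1
  simp only [h2.mul_pow, conj_pow] at h3
  rw [Subgroup.mem_center_iff.1 hx y] at h3
  simpa using h3

theorem mul_pow_three_of_commutator_pow_three {G : Type*} [Group G] {x y : G}
    (hc : ⁅x, y⁆ ∈ Subgroup.center G) (hc3 : ⁅x, y⁆ ^ 3 = 1) : (x * y) ^ 3 = x ^ 3 * y ^ 3 := by
  obtain ⟨d, hd⟩ : ∃ d, d = ⁅x, y⁆⁻¹ := ⟨_, rfl⟩
  have hdc : ∀ z, z * d = d * z := Subgroup.mem_center_iff.1 (hd ▸ inv_mem hc)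
  have hd3 : ∀ z, d * (d * (d * z)) = z := fun z => by
    rw [← mul_assoc d d, ← mul_assoc, ← pow_three', hd, inv_pow, hc3, inv_one, one_mul]
  have hxd : ∀ z, x * (d * z) = d * (x * z) := fun z => by rw [← mul_assoc, hdc, mul_assoc]
  have hyd : ∀ z, y * (d * z) = d * (y * z) := fun z => by rw [← mul_assoc, hdc, mul_assoc]
  have hyx : ∀ z, y * (x * z) = d * (x * (y * z)) := fun z => by
    rw [hd, commutatorElement_def]; group
  simp only [pow_three, mul_assoc, hyx, hxd, hyd, hd3]

theorem eq_or_mul_eq_one_of_pow_three_eq_one {D : Type*} [DivisionRing D] {u v : D} (huv : Commute u v)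
    (hu : u ^ 3 = 1) (hv : v ^ 3 = 1) (hu1 : u ≠ 1) (hv1 : v ≠ 1) : u = v ∨ u * v = 1 := by
  have key : ∀ w : D, w ^ 3 = 1 → w ≠ 1 → w ^ 2 + w + 1 = 0 := fun w hw hw1 => by
    have : (w - 1) * (w ^ 2 + w + 1) = 0 := by
      rw [← sub_eq_zero.2 hw]; noncomm_ring
    exact (mul_eq_zero.1 this).resolve_left (sub_ne_zero.2 hw1)
  have h1 := key u hu hu1
  have h2 := key v hv hv1
  have h3 : (u - v) * (u - v ^ 2) = 0 := by
    have : (u - v) * (u - v ^ 2) = (u ^ 2 + u + 1) - u * (v ^ 2 + v + 1) + (v ^ 3 - 1) := by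
      rw [sub_mul, mul_sub, mul_sub, ← huv.eq]; noncomm_ring
    rw [this, h1, h2, hv]; simp
  rcases mul_eq_zero.1 h3 with h | h
  · exact Or.inl (sub_eq_zero.1 h)
  · right
    rw [sub_eq_zero.1 h, ← hv]; noncomm_ring

section

variable {g : ℕ} {D : Type*} [DivisionRing D] [Algebra ℚ D] [FiniteDimensional ℚ D]
  {G : Type*} [Group G] [Finite G]

theorem orderOf_of_injective_units (hg : g.Prime) (hodd : Odd g)
    (hK2 : Module.finrank ℚ (Subalgebra.center ℚ D) = 2) (hD : Module.finrank ℚ D = 2 * g ^ 2)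
    {φ : G →* Dˣ} (hφ : Function.Injective φ) (x : G) :
    (orderOf x).totient ≤ 2 ∨
      ((2 * g + 1).Prime ∧ (orderOf x = 2 * g + 1 ∨ orderOf x = 2 * (2 * g + 1))) ∨
      (g = 3 ∧ (orderOf x = 9 ∨ orderOf x = 18)) := by
  have hx : orderOf (φ x : D) = orderOf x := by rw [orderOf_units, orderOf_injective φ hφ]
  rw [← hx]
  exact Nat.totient_le_two_or_of_dvd_two_mul_prime hg hodd
    (totient_orderOf_dvd hg hK2 hD (hx ▸ orderOf_pos x))

theorem mem_center_of_totient_orderOf_le_two (hg : g.Prime) (hodd : Odd g)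
    (hK2 : Module.finrank ℚ (Subalgebra.center ℚ D) = 2) (hD : Module.finrank ℚ D = 2 * g ^ 2)
    {φ : G →* Dˣ} (hφ : Function.Injective φ) {x : G} (hx : (orderOf x).totient ≤ 2) :
    x ∈ Subgroup.center G := by
  have hx' : orderOf (φ x : D) = orderOf x := by rw [orderOf_units, orderOf_injective φ hφ]
  have := mem_center_of_totient_le_two hg hodd hK2 hD (hx' ▸ orderOf_pos x) (hx'.symm ▸ hx)
  rw [Subgroup.mem_center_iff]
  intro y
  apply hφ
  ext
  simpa using Subalgebra.mem_center_iff.1 this (φ y)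

theorem mul_comm_of_injective_units (hg : g.Prime) (hodd : Odd g)
    (hK2 : Module.finrank ℚ (Subalgebra.center ℚ D) = 2) (hD : Module.finrank ℚ D = 2 * g ^ 2)
    {φ : G →* Dˣ} (hφ : Function.Injective φ) (a b : G) : a * b = b * a := by
  have htype := orderOf_of_injective_units hg hodd hK2 hD hφ
  have hcen : ∀ {x : G}, (orderOf x).totient ≤ 2 → x ∈ Subgroup.center G :=
    mem_center_of_totient_orderOf_le_two hg hodd hK2 hD hφ
  have hcen6 : ∀ {x : G}, x ^ 6 = 1 → x ∈ Subgroup.center G := fun h =>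
    hcen (Nat.totient_le_two_of_dvd_six (orderOf_dvd_of_pow_eq_one h))
  have hcen2 : ∀ {x : G}, x ^ 2 = 1 → x ∈ Subgroup.center G := fun {x} h => hcen6 (by
    rw [show 6 = 2 * 3 from rfl, pow_mul, h, one_pow])
  have hg2 := hg.two_le
  by_contra hab
  have hnc : ∀ {x y : G}, x * y ≠ y * x → ¬ (orderOf x).totient ≤ 2 := fun {x y} hxy h =>
    hxy ((Subgroup.mem_center_iff.1 (hcen h) y).symm)
  by_cases h9 : ∃ z : G, g = 3 ∧ (orderOf z = 9 ∨ orderOf z = 18)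
  · obtain ⟨z, rfl, hz⟩ := h9
    have hz6 : orderOf (z ^ 6) = 3 := by
      rcases hz with hz | hz <;> rw [orderOf_pow, hz] <;> norm_num
    have hz6c : z ^ 6 ∈ Subgroup.center G := hcen (by rw [hz6]; decide)
    have h18 : ∀ x : G, ¬ (orderOf x).totient ≤ 2 → x ^ 18 = 1 := by
      intro x hx
      rcases (htype x).resolve_left hx with ⟨-, h⟩ | ⟨-, h⟩
      · exfalso
        have hx2 : orderOf (x ^ 2) = 7 := by
          rcases h with h | h <;> rw [orderOf_pow, h] <;> norm_num
        have h21 := Commute.orderOf_mul_eq_mul_orderOf_of_coprime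
          (Subgroup.mem_center_iff.1 hz6c (x ^ 2)) (by rw [hx2, hz6]; norm_num)
        rw [hx2, hz6] at h21
        have h12 : Nat.totient 21 = 12 := by decide
        have := htype (x ^ 2 * z ^ 6)
        rw [h21] at this
        norm_num [h12] at this
      · rw [← orderOf_dvd_iff_pow_eq_one]
        rcases h with h | h <;> rw [h] <;> norm_num
    have hq : ∀ x : G, x ^ 3 ∈ Subgroup.center G := by
      intro x
      by_cases hx : (orderOf x).totient ≤ 2
      · exact pow_mem (hcen hx) 3
      · exact hcen6 (by rw [← pow_mul]; exact h18 x hx)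
    have : Fact (Nat.Prime 3) := ⟨Nat.prime_three⟩
    obtain ⟨x, y, hxy, hc⟩ := exists_commutator_mem_center_of_pow_mem_center hq hab
    have key : ∀ w : G, ¬ (orderOf w).totient ≤ 2 →
        ((φ (w ^ 6) : Dˣ) : D) ^ 3 = 1 ∧ ((φ (w ^ 6) : Dˣ) : D) ≠ 1 := by
      intro w hw
      constructor
      · rw [← Units.val_pow_eq_pow_val, ← map_pow, ← pow_mul, h18 w hw]; simp
      · intro h
        refine hw (Nat.totient_le_two_of_dvd_six (orderOf_dvd_of_pow_eq_one (hφ ?_)))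
        rw [map_one]
        exact Units.ext h
    have hx := key x (hnc hxy)
    have hy := key y (hnc hxy.symm)
    have hx6 : x ^ 6 ∈ Subgroup.center G := by
      rw [show 6 = 3 * 2 from rfl, pow_mul]; exact pow_mem (hq x) 2
    have hcomm : Commute (φ (x ^ 6) : D) (φ (y ^ 6) : D) := by
      have := congrArg (fun z => ((φ z : Dˣ) : D)) (Subgroup.mem_center_iff.1 hx6 (y ^ 6))
      simp only [map_mul, Units.val_mul] at this
      exact this.symm
    have h6 : ∀ w : G, ⁅x, w⁆ ∈ Subgroup.center G → (x * w) ^ 6 = x ^ 6 * w ^ 6 := by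
      intro w hw
      rw [show 6 = 3 * 2 from rfl, pow_mul, mul_pow_three_of_commutator_pow_three hw
        (commutator_pow_eq_one_of_pow_mem_center hw (hq x)),
        Commute.mul_pow (Subgroup.mem_center_iff.1 (hq w) (x ^ 3)), pow_mul, pow_mul]
    rcases eq_or_mul_eq_one_of_pow_three_eq_one hcomm hx.1 hy.1 hx.2 hy.2 with h | h
    · have h' : x ^ 6 = y ^ 6 := hφ (Units.ext h)
      have hcy : ⁅x, y⁻¹⁆ ∈ Subgroup.center G := by
        have : ⁅x, y⁻¹⁆ = y⁻¹ * ⁅x, y⁆⁻¹ * y := by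
          simp only [commutatorElement_def]; group
        rw [this, Subgroup.mem_center_iff.1 (inv_mem hc) y⁻¹, inv_mul_cancel_right]
        exact inv_mem hc
      have := hcen6 (x := x * y⁻¹) (by rw [h6 _ hcy, h']; group)
      have := Subgroup.mem_center_iff.1 this y
      apply hxy
      rw [← mul_assoc, inv_mul_cancel_right] at this
      exact (mul_inv_eq_iff_eq_mul.1 this).symm
    · have h' : x ^ 6 * y ^ 6 = 1 := hφ (Units.ext (by simpa using h))
      have := hcen6 (x := x * y) (by rw [h6 _ hc, h'])
      have := Subgroup.mem_center_iff.1 this y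
      apply hxy
      rw [← mul_assoc] at this
      exact (mul_right_cancel this).symm
  · have hp : ∀ x : G, ¬ (orderOf x).totient ≤ 2 →
        (2 * g + 1).Prime ∧ (orderOf x = 2 * g + 1 ∨ orderOf x = 2 * (2 * g + 1)) := fun x hx =>
      ((htype x).resolve_left hx).resolve_right fun h => h9 ⟨x, h⟩
    have hpr := (hp a (hnc hab)).1
    have hq : ∀ x : G, x ^ (2 * g + 1) ∈ Subgroup.center G := by
      intro x
      by_cases hx : (orderOf x).totient ≤ 2
      · exact pow_mem (hcen hx) _
      · refine hcen2 ?_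
        rw [← pow_mul, ← orderOf_dvd_iff_pow_eq_one, mul_comm]
        rcases (hp x hx).2 with h | h <;> simp [h]
    have : Fact (2 * g + 1).Prime := ⟨hpr⟩
    obtain ⟨x, y, hxy, hc⟩ := exists_commutator_mem_center_of_pow_mem_center hq hab
    have hc1 : ⁅x, y⁆ ≠ 1 := fun h => hxy (commutatorElement_eq_one_iff_mul_comm.1 h)
    have hcp : orderOf (φ ⁅x, y⁆ : D) = 2 * g + 1 := by
      rw [orderOf_units, orderOf_injective φ hφ]
      exact orderOf_eq_prime (commutator_pow_eq_one_of_pow_mem_center hc (hq x)) hc1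
    have hcD : (φ ⁅x, y⁆ : D) ∉ Subalgebra.center ℚ D := by
      intro h
      have := Subalgebra.totient_orderOf_dvd_finrank _ h (by rw [hcp]; omega)
      rw [hK2, hcp, Nat.totient_prime hpr] at this
      have := Nat.le_of_dvd two_pos this
      omega
    have hcz : ∀ z : G, (φ ⁅x, y⁆ : D) * φ z = φ z * φ ⁅x, y⁆ := fun z => by
      rw [← Units.val_mul, ← Units.val_mul, ← map_mul, ← map_mul, Subgroup.mem_center_iff.1 hc z]
    apply hxy
    apply hφ
    ext
    simpa using mul_comm_of_commute_of_notMem_center hg hK2 hD hcD (hcz x) (hcz y)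

end


/-- Let `g` be an odd prime and `D` a division ring, finite-dimensional as a
`ℚ`-algebra, whose center `K` is a totally imaginary quadratic number field, with
`dim_K D = g²`. Any finite group `G` of even order embedding into `Dˣ` is cyclic, with
order as listed. -/
theorem stmt0 (g : ℕ) (hg : g.Prime) (hodd : Odd g)
    (D : Type*) [DivisionRing D] [Algebra ℚ D] [FiniteDimensional ℚ D]
    (hK2 : Module.finrank ℚ (Subalgebra.center ℚ D) = 2)
    (hKimag : IsEmpty ((Subalgebra.center ℚ D) →+* ℝ))
    (hdeg : Module.finrank (Subalgebra.center ℚ D) D = g ^ 2)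
    (G : Type*) [Group G] [Finite G] (heven : Even (Nat.card G))
    (φ : G →* Dˣ) (hφ : Function.Injective φ) :
    IsCyclic G ∧
      (g = 3 → Nat.card G ∈ ({2, 4, 6, 14, 18} : Set ℕ)) ∧
      (5 ≤ g → (2 * g + 1).Prime → Nat.card G ∈ ({2, 4, 6, 4 * g + 2} : Set ℕ)) ∧
      (5 ≤ g → ¬ (2 * g + 1).Prime → Nat.card G ∈ ({2, 4, 6} : Set ℕ)) := by
  have hD := finrank_rat_of_finrank_center hK2 hdeg
  have hcyc : IsCyclic G := isCyclic_of_injective_of_forall_mul_comm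
    (mul_comm_of_injective_units hg hodd hK2 hD hφ) φ hφ
  refine ⟨hcyc, ?_⟩
  obtain ⟨x, hx⟩ := hcyc.exists_ofOrder_eq_natCard
  have h := orderOf_of_injective_units hg hodd hK2 hD hφ x
  rw [hx] at h
  have hsmall : (Nat.card G).totient ≤ 2 →
      Nat.card G = 2 ∨ Nat.card G = 4 ∨ Nat.card G = 6 := by
    intro h2
    have hpos := Nat.totient_pos.2 (Nat.card_pos (α := G))
    have h12 : (Nat.card G).totient = 1 ∨ (Nat.card G).totient = 2 := by omega
    obtain ⟨k, hk⟩ := heven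
    rcases h12 with h1 | h1
    · have := Nat.totient_eq_one_iff.1 h1
      omega
    · have := Nat.eq_of_totient_eq_two h1
      omega
  obtain ⟨k, hk⟩ := heven
  simp only [Set.mem_insert_iff, Set.mem_singleton_iff]
  rcases h with h | ⟨hp, h⟩ | ⟨rfl, h⟩
  · have := hsmall h
    exact ⟨fun _ => by omega, fun _ _ => by omega, fun _ _ => by omega⟩
  · exact ⟨fun _ => by omega, fun _ _ => by omega, fun _ hn => absurd hp hn⟩
  · exact ⟨fun _ => by omega, fun _ _ => by omega, fun _ _ => by omega⟩
end

section
/- Let g be an odd prime and let D be a division ring, finite-dimensional as a ℚ-algebra, whose center K is a totally imaginary quadratic number field and such that dim_K D = g². Let m and r be coprime positive integers with m even, let n be the multiplicative order of r modulo m, and suppose n = g. Set s = gcd(r−1, m) and t = m/s. Then there do not exist elements a, b ∈ D^× such that a has multiplicative order exactly m, b^g = a^t, b·a·b⁻¹ = a^r, and the subgroup of D^× generated by a and b has exactly m·g elements. (Equivalently, the group G_{m,r} of order mn with presentation ⟨a, b | a^m = 1, b^n = a^t, b a b⁻¹ = a^r⟩, which has even order and is not cyclic, cannot be embedded in D^×.)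 -/
open Polynomial in
theorem aeval_cyclotomic_orderOf {D : Type*} [DivisionRing D] [Algebra ℚ D] (a : Dˣ)
    (ha : 0 < orderOf a) : aeval (a : D) (cyclotomic (orderOf a) ℚ) = 0 := by
  have hprod : aeval (a : D) (∏ d ∈ (orderOf a).divisors, cyclotomic d ℚ) = 0 := by
    rw [prod_cyclotomic_eq_X_pow_sub_one ha]
    simp [← Units.val_pow_eq_pow_val, pow_orderOf_eq_one]
  have hex : ∀ S : Finset ℕ, aeval (a : D) (∏ d ∈ S, cyclotomic d ℚ) = 0 →
      ∃ d ∈ S, aeval (a : D) (cyclotomic d ℚ) = 0 := by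
    intro S
    induction S using Finset.induction_on with
    | empty => simp
    | insert d S hd ih =>
      intro h
      rw [Finset.prod_insert hd, map_mul, mul_eq_zero] at h
      rcases h with h | h
      · exact ⟨d, Finset.mem_insert_self _ _, h⟩
      · obtain ⟨e, he, h⟩ := ih h
        exact ⟨e, Finset.mem_insert_of_mem he, h⟩
  obtain ⟨d, hd, h⟩ := hex _ hprod
  have hda : a ^ d = 1 := by
    obtain ⟨q, hq⟩ := cyclotomic.dvd_X_pow_sub_one d ℚ
    have := congrArg (aeval (a : D)) hq
    rw [map_mul, h, zero_mul] at this
    ext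
    simpa [sub_eq_zero] using this
  rwa [Nat.dvd_antisymm (Nat.dvd_of_mem_divisors hd) (orderOf_dvd_of_pow_eq_one hda)] at h

open Polynomial in
theorem totient_orderOf_dvd_finrank {D : Type*} [DivisionRing D] [Algebra ℚ D]
    (a : Dˣ) (ha : 0 < orderOf a) : Nat.totient (orderOf a) ∣ Module.finrank ℚ D := by
  set f := cyclotomic (orderOf a) ℚ with hf
  have : Fact (Irreducible f) := ⟨cyclotomic.irreducible_rat ha⟩
  let φ : AdjoinRoot f →+* D := Ideal.Quotient.lift (Ideal.span {f})
    (aeval (R := ℚ) (a : D)).toRingHom (fun p hp => by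
      obtain ⟨q, rfl⟩ := Ideal.mem_span_singleton.1 hp
      change aeval (a : D) (f * q) = 0
      rw [map_mul, aeval_cyclotomic_orderOf a ha, zero_mul])
  let _ : Module (AdjoinRoot f) D := Module.compHom D φ
  have : IsScalarTower ℚ (AdjoinRoot f) D := by
    refine IsScalarTower.of_algebraMap_smul fun q x => ?_
    change φ (algebraMap ℚ (AdjoinRoot f) q) * x = q • x
    rw [Algebra.smul_def]
    congr 1
    exact RingHom.congr_fun (Subsingleton.elim (φ.comp (algebraMap ℚ (AdjoinRoot f)))
      (algebraMap ℚ D)) q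
  have h := Module.finrank_mul_finrank ℚ (AdjoinRoot f) D
  have hL : Module.finrank ℚ (AdjoinRoot f) = Nat.totient (orderOf a) := by
    rw [(AdjoinRoot.powerBasis (cyclotomic_ne_zero (orderOf a) ℚ)).finrank,
      AdjoinRoot.powerBasis_dim, natDegree_cyclotomic]
  rw [← h, hL]
  exact dvd_mul_right _ _

theorem pow_ne_one_of_conj_eq_pow {D : Type*} [DivisionRing D] [Algebra ℚ D] {g r : ℕ}
    (hg : 1 < g) (a z : Dˣ) (hz : z * a * z⁻¹ = a ^ r)
    (hr : orderOf (r : ZMod (orderOf a)) = g) : z ^ g ≠ 1 := by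
  intro hzg
  let L := Algebra.adjoin ℚ {(a : D)}
  have : IsMulCommutative L := Algebra.isMulCommutative_adjoin ℚ (by
    rintro x rfl y rfl
    rfl)
  let α : L := ⟨a, Algebra.subset_adjoin rfl⟩
  have hz' : ∀ k, z * a ^ k = a ^ (r * k) * z := by
    intro k
    rw [pow_mul, ← hz, conj_pow]
    group
  have hzi : ∀ i, z ^ i * a = a ^ (r ^ i) * z ^ i := by
    intro i
    induction i with
    | zero => simp
    | succ i ih => rw [pow_succ', mul_assoc, ih, ← mul_assoc, hz', mul_assoc, ← pow_succ', pow_succ' r]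
  let T : Module.End L D :=
    { toFun := fun x => x * a
      map_add' := fun x y => add_mul x y _
      map_smul' := fun c x => mul_assoc (c : D) x a }
  have hinj : Function.Injective fun i : Fin g => α ^ (r ^ (i : ℕ)) := by
    intro i j hij
    have h1 : a ^ (r ^ (i : ℕ)) = a ^ (r ^ (j : ℕ)) := by
      ext
      simpa [α] using congrArg Subtype.val hij
    have h2 := pow_eq_pow_iff_modEq.1 h1
    have h3 := (ZMod.natCast_eq_natCast_iff _ _ _).2 h2
    push_cast at h3
    refine Fin.ext (pow_injOn_Iio_orderOf (x := (r : ZMod (orderOf a))) ?_ ?_ h3)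
    · simp [hr]
    · simp [hr]
  have hli := Module.End.eigenvectors_linearIndependent' T
    (fun i : Fin g => α ^ (r ^ (i : ℕ))) hinj (fun i => ((z ^ (i : ℕ) : Dˣ) : D)) (by
      intro i
      rw [Module.End.hasEigenvector_iff, Module.End.mem_eigenspace_iff]
      refine ⟨?_, Units.ne_zero _⟩
      change ((z ^ (i : ℕ) : Dˣ) : D) * a = ((α ^ (r ^ (i : ℕ)) : L) : D) * _
      have := congrArg Units.val (hzi i)
      simpa [α] using this)
  have hz1 : (z : D) - 1 ≠ 0 := by
    intro h
    have h1 : z = 1 := by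
      ext
      simpa [sub_eq_zero] using h
    have h2 := hinj (a₁ := ⟨0, by omega⟩) (a₂ := ⟨1, hg⟩) (by
      ext
      have := congrArg Units.val hz
      simpa [α, h1] using this)
    simp at h2
  have hsum : ∑ i ∈ Finset.range g, (z : D) ^ i = 0 := by
    have h := mul_geom_sum (z : D) g
    rw [← Units.val_pow_eq_pow_val, hzg, Units.val_one, sub_self] at h
    exact (mul_eq_zero.1 h).resolve_left hz1
  have h0 := Fintype.linearIndependent_iff.1 hli (fun _ => 1) (by
    rw [Finset.sum_range] at hsum
    simpa using hsum) ⟨0, by omega⟩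
  exact one_ne_zero h0

theorem eq_of_totient_dvd_eighteen {m : ℕ} (hm : 0 < m) (heven : Even m) (h3 : 3 ∣ m)
    (h : Nat.totient m ∣ 18) : m = 6 ∨ m = 18 ∨ m = 54 := by
  obtain ⟨k, q, hq, rfl⟩ := Nat.exists_eq_pow_mul_and_not_dvd hm.ne' 3 (by norm_num)
  have hcop : Nat.Coprime 3 q := (Nat.Prime.coprime_iff_not_dvd Nat.prime_three).2 hq
  have hk : 0 < k := by
    rcases Nat.eq_zero_or_pos k with rfl | hk
    · simp at h3; omega
    · exact hk
  rw [Nat.totient_mul (hcop.pow_left k), Nat.totient_prime_pow Nat.prime_three hk] at h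
  have hq2 : q ≤ 2 := by
    by_contra! hq2
    obtain ⟨c, hc⟩ := (Nat.totient_even hq2).two_dvd
    have : 4 ∣ 18 := dvd_trans ⟨3 ^ (k - 1) * c, by rw [hc]; ring⟩ h
    omega
  have hqe : q = 2 := by
    rw [Nat.even_mul] at heven
    have h3k : ¬ Even (3 ^ k) := by
      rw [Nat.not_even_iff_odd]
      exact Odd.pow (by decide)
    have hqe := heven.resolve_left h3k
    interval_cases q <;> simp_all
  subst hqe
  obtain ⟨j, rfl⟩ : ∃ j, k = j + 1 := ⟨k - 1, by omega⟩
  have hj : j ≤ 2 := by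
    by_contra! hj
    have h27 : 3 ^ 3 ∣ 18 :=
      ((pow_dvd_pow 3 hj).trans ⟨2, by simp⟩ : 3 ^ 3 ∣ _).trans h
    omega
  interval_cases j <;> simp

theorem exists_dvd_mul_add_div_gcd {m r : ℕ} (hm : m = 6 ∨ m = 18 ∨ m = 54)
    (hr : 0 < r) (hord : orderOf (r : ZMod m) = 3) :
    ∃ k, m ∣ k * (1 + r + r ^ 2) + m / Nat.gcd (r - 1) m := by
  have h1 : (r : ZMod m) ≠ 1 := by
    intro h
    rw [h, orderOf_one] at hord
    omega
  have h3 : (r : ZMod m) ^ 3 = 1 := hord ▸ pow_orderOf_eq_one _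
  obtain ⟨c, rfl⟩ : ∃ c, r = c + 1 := ⟨r - 1, by omega⟩
  have hm0 : 0 < m := by omega
  have hgcd : Nat.gcd (c + 1 - 1) m = Nat.gcd (c % m) m := by
    rw [Nat.add_sub_cancel, Nat.gcd_comm, Nat.gcd_rec]
  have hcast : ((c + 1 : ℕ) : ZMod m) = ((c % m + 1 : ℕ) : ZMod m) := by simp
  have key : ∀ k, (m ∣ k * (1 + (c + 1) + (c + 1) ^ 2) + m / Nat.gcd (c % m) m) ↔
      (m ∣ k * (1 + (c % m + 1) + (c % m + 1) ^ 2) + m / Nat.gcd (c % m) m) := by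
    intro k
    rw [← ZMod.natCast_eq_zero_iff, ← ZMod.natCast_eq_zero_iff]
    push_cast
    rw [ZMod.natCast_mod]
  simp_rw [hgcd, key]
  rw [hcast] at h1 h3
  have hlt := Nat.mod_lt c hm0
  generalize c % m = d at *
  suffices H : ∃ k < m, m ∣ k * (1 + (d + 1) + (d + 1) ^ 2) + m / Nat.gcd d m from
    H.imp fun _ h => h.2
  clear hord hgcd hcast key hr
  rcases hm with rfl | rfl | rfl
  all_goals
    revert h1 h3
    revert d
    decide +kernel

theorem stmt1 (g : ℕ) (hg : g.Prime) (hodd : Odd g)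
    (D : Type*) [DivisionRing D] [Algebra ℚ D] [FiniteDimensional ℚ D]
    (hK2 : Module.finrank ℚ (Subalgebra.center ℚ D) = 2)
    (hKimag : IsEmpty ((Subalgebra.center ℚ D) →+* ℝ))
    (hdeg : Module.finrank (Subalgebra.center ℚ D) D = g ^ 2)
    (m r : ℕ) (hm : 0 < m) (hr : 0 < r) (hcop : Nat.Coprime m r) (hmeven : Even m)
    (hn : orderOf (r : ZMod m) = g) :
    ¬ ∃ a b : Dˣ, orderOf a = m ∧ b ^ g = a ^ (m / Nat.gcd (r - 1) m) ∧
        b * a * b⁻¹ = a ^ r ∧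
        Nat.card (Subgroup.closure ({a, b} : Set Dˣ)) = m * g := by
  rintro ⟨a, b, rfl, hbg, hconj, -⟩
  have hbk : ∀ k, b * a ^ k = a ^ (r * k) * b := by
    intro k
    rw [pow_mul, ← hconj, conj_pow]
    group
  set m := orderOf a with hma
  set s := Nat.gcd (r - 1) m with hs
  have hsm : s ∣ m := Nat.gcd_dvd_right _ _
  have hsr : s ∣ r - 1 := Nat.gcd_dvd_left _ _
  by_cases hgs : g ∣ s
  · have hfin : Nat.totient m ∣ 2 * g ^ 2 := by
      have h := totient_orderOf_dvd_finrank a hm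
      let _ : Field (Subalgebra.center ℚ D) := inferInstanceAs (Field (Subring.center D))
      have h2 := Module.finrank_mul_finrank ℚ (Subalgebra.center ℚ D) D
      rw [hK2, hdeg] at h2
      rwa [h2]
    have hg3 : g = 3 := by
      have h1 : g - 1 ∣ 2 * g ^ 2 := by
        rw [← Nat.totient_prime hg]
        exact (Nat.totient_dvd_of_dvd (hgs.trans hsm)).trans hfin
      have hc : Nat.Coprime (g - 1) (g ^ 2) := by
        refine Nat.Coprime.pow_right _ ?_
        have := Nat.coprime_self_add_right (m := g - 1) (n := 1)
        rw [Nat.sub_add_cancel hg.one_le] at this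
        exact this.2 (Nat.coprime_one_right _)
      have h2 := Nat.le_of_dvd two_pos (hc.dvd_of_dvd_mul_right h1)
      have := hg.two_le
      obtain ⟨c, rfl⟩ := hodd
      omega
    subst hg3
    obtain ⟨k, hk⟩ := exists_dvd_mul_add_div_gcd
      (eq_of_totient_dvd_eighteen hm hmeven (hgs.trans hsm) hfin) hr hn
    refine pow_ne_one_of_conj_eq_pow (g := 3) (by norm_num) a (a ^ k * b) ?_ hn ?_
    · calc _ = a ^ k * (b * a * b⁻¹) * (a ^ k)⁻¹ := by group
        _ = a ^ r := by rw [hconj, (Commute.pow_pow_self a k r).eq, mul_inv_cancel_right]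
    · have : (a ^ k * b) ^ 3 = a ^ (k * (1 + r + r ^ 2)) * b ^ 3 := by
        have e1 : b * (a ^ k * b) = a ^ (r * k) * b ^ 2 := by
          rw [← mul_assoc, hbk, mul_assoc, sq]
        have e2 : b * (a ^ k * (a ^ (r * k) * b ^ 2)) =
            a ^ (r * k + r * (r * k)) * b ^ 3 := by
          rw [← mul_assoc (a ^ k), ← pow_add, ← mul_assoc, hbk, mul_assoc, ← pow_succ', mul_add]
        rw [pow_succ', sq, mul_assoc, mul_assoc (a ^ k) b, e1, e2, ← mul_assoc, ← pow_add]
        congr 2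
        ring
      rw [this, hbg, ← pow_add]
      exact orderOf_dvd_iff_pow_eq_one.1 hk
  · have hxs : (a ^ (m / s)) ^ s = 1 := by
      rw [← pow_mul, Nat.div_mul_cancel hsm, pow_orderOf_eq_one]
    have hc : Nat.Coprime g (orderOf (a ^ (m / s))) :=
      Nat.Coprime.coprime_dvd_right (orderOf_dvd_of_pow_eq_one hxs)
        (hg.coprime_iff_not_dvd.2 hgs)
    obtain ⟨j, hj⟩ := exists_pow_eq_self_of_coprime hc
    have hbx : Commute b (a ^ (m / s)) := by
      rw [Commute, SemiconjBy, hbk]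
      congr 1
      obtain ⟨c, hc⟩ := hsr
      have hrc : r = s * c + 1 := by omega
      rw [show r * (m / s) = m / s * s * c + m / s by rw [hrc]; ring,
        Nat.div_mul_cancel hsm, pow_add, pow_mul, pow_orderOf_eq_one, one_pow, one_mul]
    have hcomm : Commute (((a ^ (m / s)) ^ j)⁻¹) b := ((hbx.pow_right j).inv_right).symm
    refine pow_ne_one_of_conj_eq_pow hg.one_lt a (((a ^ (m / s)) ^ j)⁻¹ * b) ?_ hn ?_
    · have hca : Commute (((a ^ (m / s)) ^ j)⁻¹) (a ^ r) :=
        (((Commute.refl a).pow_pow _ r).pow_left j).inv_left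
      calc _ = ((a ^ (m / s)) ^ j)⁻¹ * (b * a * b⁻¹) * (((a ^ (m / s)) ^ j)⁻¹)⁻¹ := by group
        _ = a ^ r := by rw [hconj, hca.eq, mul_inv_cancel_right]
    · rw [hcomm.mul_pow, hbg, inv_pow, ← pow_mul, mul_comm j, pow_mul, hj, inv_mul_cancel]
end

section
/- Let g be an odd prime and let D be a division ring, finite-dimensional as a ℚ-algebra, whose center K is a totally imaginary quadratic number field and such that dim_K D = g². If x ∈ D^× has finite multiplicative order m, then Euler's totient φ(m) divides 2g. -/
/-- A commutative subalgebra of a finite-dimensional division algebra is a field. -/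
theorem Subalgebra.isField_of_finiteDimensional {F D : Type*} [Field F] [DivisionRing D]
    [Algebra F D] [FiniteDimensional F D] (S : Subalgebra F D)
    (hS : ∀ a ∈ S, ∀ b ∈ S, a * b = b * a) : IsField S where
  exists_pair_ne := ⟨0, 1, zero_ne_one⟩
  mul_comm a b := Subtype.ext (hS a a.2 b b.2)
  mul_inv_cancel {a} ha := by
    obtain ⟨b, hb⟩ := (LinearMap.injective_iff_surjective (f := LinearMap.mulLeft F a)).1
      (fun x y h => mul_left_cancel₀ ha h) 1
    exact ⟨b, hb⟩

/-- The degree of a field over which a division algebra of dimension `g ^ 2` is a vector space,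
with `g` prime, divides `g` unless it equals `g ^ 2`. -/
theorem finrank_dvd_prime_of_finrank_eq_sq {K L D : Type*} [Field K] [Field L] [DivisionRing D]
    [Algebra K D] [FiniteDimensional K D] [Algebra K L] [Module L D] [IsScalarTower K L D]
    {g : ℕ} (hg : g.Prime) (hD : Module.finrank K D = g ^ 2)
    (hne : Module.finrank K L ≠ g ^ 2) : Module.finrank K L ∣ g := by
  have h : Module.finrank K L ∣ g ^ 2 := ⟨_, (hD ▸ Module.finrank_mul_finrank K L D).symm⟩
  obtain ⟨i, hi, h⟩ := (Nat.dvd_prime_pow hg).1 h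
  interval_cases i <;> simp_all

theorem IsPrimitiveRoot.totient_dvd_finrank {L : Type*} [Field L] [i : Algebra ℚ L]
    [FiniteDimensional ℚ L] {y : L} {m : ℕ} (hy : IsPrimitiveRoot y m) (hm : 0 < m) :
    m.totient ∣ Module.finrank ℚ L := by
  have : CharZero L := algebraRat.charZero L
  obtain rfl : i = DivisionRing.toRatAlgebra := Subsingleton.elim _ _
  rw [← Polynomial.natDegree_cyclotomic m ℚ, Polynomial.cyclotomic_eq_minpoly_rat hy hm]
  exact minpoly.degree_dvd (Algebra.IsIntegral.isIntegral (R := ℚ) y)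

/-- with `D` as in statement 0, if `x ∈ Dˣ` has finite multiplicative
order `m`, then `φ(m) ∣ 2g`. -/
theorem stmt2 (g : ℕ) (hg : g.Prime) (hodd : Odd g)
    (D : Type*) [DivisionRing D] [Algebra ℚ D] [FiniteDimensional ℚ D]
    (hK2 : Module.finrank ℚ (Subalgebra.center ℚ D) = 2)
    (hKimag : IsEmpty ((Subalgebra.center ℚ D) →+* ℝ))
    (hdeg : Module.finrank (Subalgebra.center ℚ D) D = g ^ 2)
    (x : Dˣ) (m : ℕ) (hm : 0 < m) (hx : orderOf x = m) :
    Nat.totient m ∣ 2 * g := by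
  have hK : IsField (Subalgebra.center ℚ D) :=
    Subalgebra.isField_of_finiteDimensional _ fun a _ b hb =>
      Subalgebra.mem_center_iff.1 hb a
  let : Field (Subalgebra.center ℚ D) := hK.toField
  let : Algebra (Subalgebra.center ℚ D) D :=
    Algebra.ofModule smul_mul_assoc fun c a b => by
      rw [Subalgebra.smul_def, Subalgebra.smul_def, smul_eq_mul, smul_eq_mul, ← mul_assoc,
        ← mul_assoc, Subalgebra.mem_center_iff.1 c.2]
  have : FiniteDimensional (Subalgebra.center ℚ D) D := Module.Finite.right ℚ _ D
  let L := Algebra.adjoin (Subalgebra.center ℚ D) {(x : D)}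
  have hcomm : ∀ a ∈ L, ∀ b ∈ L, a * b = b * a := fun a ha b hb =>
    Algebra.commute_of_mem_adjoin_singleton_of_commute hb
      (Algebra.commute_of_mem_adjoin_singleton_of_commute ha rfl).symm
  have hL : IsField L := Subalgebra.isField_of_finiteDimensional L hcomm
  let : Field L := hL.toField
  have hne : Module.finrank (Subalgebra.center ℚ D) L ≠ g ^ 2 := by
    intro h
    have htop : L = ⊤ := Subalgebra.toSubmodule_injective
      (Submodule.eq_top_of_finrank_eq (h.trans hdeg.symm))
    have hc : Subalgebra.center ℚ D = ⊤ := by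
      refine eq_top_iff.2 fun a _ => Subalgebra.mem_center_iff.2 fun b => ?_
      exact hcomm b (htop ▸ Algebra.mem_top) a (htop ▸ Algebra.mem_top)
    have h1 := Module.finrank_mul_finrank ℚ (Subalgebra.center ℚ D) D
    have h2 : Module.finrank ℚ (Subalgebra.center ℚ D) = Module.finrank ℚ D := by
      rw [hc]; exact subalgebra_top_finrank_eq_submodule_top_finrank.trans (finrank_top ℚ D)
    rw [← h2, hdeg, hK2] at h1
    nlinarith [hg.two_le]
  have hdvd := finrank_dvd_prime_of_finrank_eq_sq (L := L) hg hdeg hne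
  have hy : IsPrimitiveRoot (⟨x, Algebra.self_mem_adjoin_singleton _ _⟩ : L) m := by
    rw [IsPrimitiveRoot.iff_orderOf, ← hx, ← orderOf_units]
    exact (orderOf_injective (L.val : L →* D) Subtype.val_injective _).symm
  have : FiniteDimensional ℚ L := Module.Finite.trans (Subalgebra.center ℚ D) L
  refine (hy.totient_dvd_finrank hm).trans ?_
  rw [← Module.finrank_mul_finrank ℚ (Subalgebra.center ℚ D) L, hK2]
  exact mul_dvd_mul_left 2 hdvd
end

section
/- Let g be an odd prime and let K be a field which is an algebra over ℚ with [K : ℚ] = 2g. If G is a finite subgroup of even order of the multiplicative group K^×, then G is cyclic, and moreover: if g = 3 then |G| ∈ {2, 4, 6, 14, 18}; if g ≥ 5 and 2g+1 is a prime number then |G| ∈ {2, 4, 6, 4g+2}; if g ≥ 5 and 2g+1 is not a prime number then |G| ∈ {2, 4, 6}. -/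
/-- In a field extension of finite degree over `ℚ`, the totient of the order of a primitive root
of unity divides the degree. -/
theorem IsPrimitiveRoot.totient_dvd_finrank_rat {K : Type*} [Field K] [Algebra ℚ K]
    [FiniteDimensional ℚ K] {n : ℕ} (hn : 0 < n) {ζ : K} (h : IsPrimitiveRoot ζ n) :
    n.totient ∣ Module.finrank ℚ K := by
  have : CharZero K := algebraRat.charZero K
  have hd := minpoly.degree_dvd (K := ℚ) (Algebra.IsIntegral.isIntegral ζ)
  have : minpoly ℚ ζ = Polynomial.cyclotomic n ℚ := by
    convert (Polynomial.cyclotomic_eq_minpoly_rat h hn).symm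
    exact Subsingleton.elim _ _
  rwa [this, Polynomial.natDegree_cyclotomic] at hd

theorem Subgroup.totient_card_dvd_finrank_rat {K : Type*} [Field K] [Algebra ℚ K]
    [FiniteDimensional ℚ K] (G : Subgroup Kˣ) [Finite G] :
    (Nat.card G).totient ∣ Module.finrank ℚ K := by
  obtain ⟨x, hx⟩ := IsCyclic.exists_ofOrder_eq_natCard (α := G)
  refine IsPrimitiveRoot.totient_dvd_finrank_rat (ζ := ((x : Kˣ) : K)) Nat.card_pos ?_
  rw [← hx, ← Subgroup.orderOf_coe, ← orderOf_units]
  exact IsPrimitiveRoot.orderOf _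

/-- The even numbers whose totient divides twice an odd prime. -/
theorem Nat.eq_of_totient_dvd_two_mul_prime {g n : ℕ} (hg : g.Prime) (hodd : Odd g)
    (hn : Even n) (h : n.totient ∣ 2 * g) :
    n = 2 ∨ n = 4 ∨ n = 6 ∨ (g = 3 ∧ n = 18) ∨ ((2 * g + 1).Prime ∧ n = 4 * g + 2) := by
  have hn0 : n ≠ 0 := by
    rintro rfl
    simp [hg.ne_zero] at h
  have h4 : ¬ 4 ∣ 2 * g := by
    obtain ⟨k, rfl⟩ := hodd
    omega
  by_cases hp : ∃ p, p.Prime ∧ Odd p ∧ p ∣ n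
  · obtain ⟨p, hp, hpo, hpn⟩ := hp
    have hp3 : 3 ≤ p := by
      have := hp.two_le
      obtain ⟨k, rfl⟩ := hpo
      omega
    obtain ⟨k, m, hpm, rfl⟩ := Nat.exists_eq_pow_mul_and_not_dvd hn0 p hp.ne_one
    obtain _ | j := k
    · simp [hpm] at hpn
    have hcop : (p ^ (j + 1)).Coprime m :=
      Nat.Coprime.pow_left _ ((Nat.Prime.coprime_iff_not_dvd hp).2 hpm)
    rw [Nat.totient_mul hcop, Nat.totient_prime_pow_succ hp] at h
    have hp1 : 2 ∣ p - 1 := by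
      obtain ⟨k, rfl⟩ := hpo
      omega
    have hm : Odd m.totient := by
      rw [← Nat.not_even_iff_odd, even_iff_two_dvd]
      intro hm
      exact h4 (((mul_dvd_mul hp1 hm).trans
        (mul_dvd_mul_right (dvd_mul_left _ _) _)).trans h)
    have hm2 : m = 2 := by
      rcases Nat.odd_totient_iff.1 hm with rfl | rfl
      · simp [Nat.even_pow, Nat.not_even_iff_odd.2 hpo] at hn
      · rfl
    subst hm2
    simp only [Nat.totient_two, mul_one] at h
    obtain _ | j := j
    · obtain ⟨r, hr⟩ := hp1
      rw [pow_zero, one_mul, hr, Nat.mul_dvd_mul_iff_left two_pos] at h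
      have hpr : p = 2 * r + 1 := by omega
      rcases (Nat.dvd_prime hg).1 h with rfl | rfl
      · exact Or.inr (Or.inr (Or.inl (by simp [hpr])))
      · rw [hpr] at hp ⊢
        exact Or.inr (Or.inr (Or.inr (Or.inr ⟨hp, by ring⟩)))
    · have hpg : p ∣ 2 * g := ((dvd_pow_self p (by omega)).mul_right _).trans h
      obtain rfl : p = g := by
        rcases (Nat.Prime.dvd_mul hp).1 hpg with h2 | h2
        · have := Nat.le_of_dvd two_pos h2
          omega
        · exact (Nat.prime_dvd_prime_iff_eq hp hg).1 h2
      rw [show p ^ (j + 1) * (p - 1) = p ^ j * (p - 1) * p by ring,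
        Nat.mul_dvd_mul_iff_right hp.pos] at h
      have hle := Nat.le_of_dvd two_pos ((dvd_mul_left _ _).trans h)
      obtain rfl : p = 3 := by omega
      obtain _ | j := j
      · simp
      · have := Nat.le_of_dvd two_pos
          (((dvd_pow_self 3 j.succ_ne_zero).mul_right _).trans h)
        omega
  · push Not at hp
    have hpow := Nat.eq_prime_pow_of_unique_prime_dvd hn0 (p := 2) fun {d} hd hdn =>
      hd.eq_two_or_odd'.resolve_right fun ho => hp d hd ho hdn
    generalize n.primeFactorsList.length = k at hpow
    subst hpow
    match k with
    | 0 => simp at hn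
    | 1 => simp
    | 2 => simp
    | k + 3 =>
      rw [Nat.totient_prime_pow_succ Nat.prime_two] at h
      exact absurd (((pow_dvd_pow 2 (by omega : 2 ≤ k + 2)).mul_right _).trans h) h4

/-- Let `g` be an odd prime and `K` a field with `[K : ℚ] = 2g`. Any finite
subgroup `G` of `Kˣ` of even order is cyclic, with order as listed. -/
theorem stmt3 (g : ℕ) (hg : g.Prime) (hodd : Odd g)
    (K : Type*) [Field K] [Algebra ℚ K] (hdim : Module.finrank ℚ K = 2 * g)
    (G : Subgroup Kˣ) [Finite G] (heven : Even (Nat.card G)) :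
    IsCyclic G ∧
      (g = 3 → Nat.card G ∈ ({2, 4, 6, 14, 18} : Set ℕ)) ∧
      (5 ≤ g → (2 * g + 1).Prime → Nat.card G ∈ ({2, 4, 6, 4 * g + 2} : Set ℕ)) ∧
      (5 ≤ g → ¬ (2 * g + 1).Prime → Nat.card G ∈ ({2, 4, 6} : Set ℕ)) := by
  have : FiniteDimensional ℚ K :=
    Module.finite_of_finrank_pos (by rw [hdim]; exact Nat.mul_pos two_pos hg.pos)
  have hdvd := G.totient_card_dvd_finrank_rat
  rw [hdim] at hdvd
  have key := Nat.eq_of_totient_dvd_two_mul_prime hg hodd heven hdvd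
  simp only [Set.mem_insert_iff, Set.mem_singleton_iff]
  refine ⟨inferInstance, fun h => ?_, fun h hp => ?_, fun h hp => ?_⟩
  · omega
  · omega
  · simp only [hp, false_and, or_false] at key
    omega
end

section
/- Let g be an odd prime and let m be an even positive integer such that Euler's totient φ(m) divides 2g. Then: if g = 3, then m ∈ {2, 4, 6, 14, 18}; if g ≥ 5 and 2g+1 is a prime number, then m ∈ {2, 4, 6, 4g+2}; if g ≥ 5 and 2g+1 is not a prime number, then m ∈ {2, 4, 6}. -/
/-- If `p` is an odd prime, `p ^ e * (p - 1)` divides `2 * g` with `g` prime only for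
`p = 3` and small `e`, or `p = 2 * g + 1` and `e = 0`. -/
theorem Nat.Prime.cases_of_pow_mul_pred_dvd_two_mul {p g e : ℕ} (hp : p.Prime) (hp2 : p ≠ 2)
    (hg : g.Prime) (h : p ^ e * (p - 1) ∣ 2 * g) :
    (p = 3 ∧ e = 0) ∨ (p = 2 * g + 1 ∧ e = 0) ∨ (p = 3 ∧ e = 1 ∧ g = 3) := by
  obtain ⟨d, rfl⟩ := hp.odd_of_ne_two hp2
  have hdvd : (2 * d + 1) ^ e * d ∣ g := by
    refine Nat.dvd_of_mul_dvd_mul_left two_pos ?_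
    convert h using 1
    rw [Nat.add_sub_cancel]
    ring
  have he_of_pow : (2 * d + 1) ^ e = 1 → e = 0 := fun h1 => by
    by_contra he
    exact (Nat.one_lt_pow he hp.one_lt).ne' h1
  rcases (Nat.dvd_prime hg).1 hdvd with h1 | h1
  · obtain ⟨ha, hb⟩ := mul_eq_one.1 h1
    exact Or.inl ⟨by omega, he_of_pow ha⟩
  · rcases (Nat.dvd_prime hg).1 (Dvd.intro_left _ h1) with hd | hd
    · subst hd
      rw [mul_one] at h1
      have he : e = 1 := Nat.Prime.eq_one_of_pow (h1 ▸ hg)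
      subst he
      exact Or.inr (Or.inr ⟨rfl, rfl, by simpa using h1.symm⟩)
    · subst hd
      have ha : (2 * d + 1) ^ e = 1 := Nat.eq_of_mul_eq_mul_right hg.pos (by rw [h1, one_mul])
      exact Or.inr (Or.inl ⟨rfl, he_of_pow ha⟩)

/-- The even positive integers `m` with `φ(m) ∣ 2g`, for `g` an odd prime. -/
theorem Nat.cases_of_totient_dvd_two_mul_prime {g m : ℕ} (hg : g.Prime) (hodd : Odd g)
    (hm : 0 < m) (hmeven : Even m) (hdvd : Nat.totient m ∣ 2 * g) :
    m = 2 ∨ m = 4 ∨ m = 6 ∨ ((2 * g + 1).Prime ∧ m = 4 * g + 2) ∨ (g = 3 ∧ m = 18) := by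
  have h4 : ¬ 4 ∣ Nat.totient m := fun h => by
    have := h.trans hdvd
    obtain ⟨k, rfl⟩ := hodd
    omega
  by_cases hex : ∃ p, p.Prime ∧ p ∣ m ∧ p ≠ 2
  · obtain ⟨p, hp, hpm, hp2⟩ := hex
    obtain ⟨e, n, hpn, rfl⟩ := Nat.exists_eq_pow_mul_and_not_dvd hm.ne' p hp.ne_one
    obtain ⟨e, rfl⟩ : ∃ k, e = k + 1 := Nat.exists_eq_succ_of_ne_zero (by
      rintro rfl
      exact hpn (by simpa using hpm))
    have hcop : Nat.Coprime (p ^ (e + 1)) n := ((Nat.Prime.coprime_iff_not_dvd hp).2 hpn).pow_left _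
    have hpodd : Odd p := hp.odd_of_ne_two hp2
    rw [Nat.totient_mul hcop, Nat.totient_prime_pow_succ hp] at hdvd h4
    have hneven : Even n := (Nat.even_mul.1 hmeven).resolve_left
      (Nat.not_even_iff_odd.2 hpodd.pow)
    have hn : n = 2 := by
      by_contra hn2
      have hn0 : n ≠ 0 := by
        rintro rfl
        simp at hm
      have h2n : 2 < n := by
        obtain ⟨k, rfl⟩ := hneven
        omega
      have h2p : 2 ∣ p - 1 := by
        obtain ⟨k, rfl⟩ := hpodd
        omega
      exact h4 (mul_dvd_mul (h2p.mul_left _) (Nat.totient_even h2n).two_dvd)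
    subst hn
    rw [Nat.totient_two, mul_one] at hdvd
    rcases hp.cases_of_pow_mul_pred_dvd_two_mul hp2 hg hdvd with
      ⟨rfl, rfl⟩ | ⟨rfl, rfl⟩ | ⟨rfl, rfl, rfl⟩
    · simp
    · exact Or.inr (Or.inr (Or.inr (Or.inl ⟨hp, by ring⟩)))
    · simp
  · push Not at hex
    have hpow := Nat.eq_prime_pow_of_unique_prime_dvd hm.ne' (fun {d} hd hdm => hex d hd hdm)
    generalize m.primeFactorsList.length = k at hpow
    subst hpow
    match k with
    | 0 => simp at hmeven
    | 1 => simp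
    | 2 => simp
    | k + 3 =>
      refine absurd ?_ h4
      rw [Nat.totient_prime_pow_succ Nat.prime_two]
      exact ⟨2 ^ k, by ring⟩

/-- Let `g` be an odd prime and `m` an even positive integer with
`φ(m) ∣ 2g`. Then `m` is as listed. -/
theorem stmt4 (g : ℕ) (hg : g.Prime) (hodd : Odd g)
    (m : ℕ) (hm : 0 < m) (hmeven : Even m) (hdvd : Nat.totient m ∣ 2 * g) :
    (g = 3 → m ∈ ({2, 4, 6, 14, 18} : Set ℕ)) ∧
      (5 ≤ g → (2 * g + 1).Prime → m ∈ ({2, 4, 6, 4 * g + 2} : Set ℕ)) ∧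
      (5 ≤ g → ¬ (2 * g + 1).Prime → m ∈ ({2, 4, 6} : Set ℕ)) := by
  have key := Nat.cases_of_totient_dvd_two_mul_prime hg hodd hm hmeven hdvd
  simp only [Set.mem_insert_iff, Set.mem_singleton_iff]
  refine ⟨fun _ => by omega, fun _ _ => by omega, fun _ hnp => ?_⟩
  rcases key with h | h | h | ⟨h, -⟩ | ⟨h, -⟩
  · exact Or.inl h
  · exact Or.inr (Or.inl h)
  · exact Or.inr (Or.inr h)
  · exact absurd h hnp
  · omega
end

section
/- Let g be an odd prime such that an even positive integer d satisfies φ(d) = 2g, where φ is Euler's totient function, and suppose g ≥ 5. Then 2g+1 is a prime number and d = 4g+2. -/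
/-- An odd number whose totient is not divisible by `4` is `1` or a power of an odd prime. -/
theorem Odd.exists_eq_prime_pow_of_not_four_dvd_totient {m : ℕ} (hm : Odd m) (hm1 : m ≠ 1)
    (h4 : ¬4 ∣ m.totient) : ∃ p k : ℕ, p.Prime ∧ Odd p ∧ m = p ^ (k + 1) := by
  obtain ⟨p, hp, hpm⟩ := Nat.exists_prime_and_dvd hm1
  have hpodd : Odd p := hm.of_dvd_nat hpm
  obtain ⟨e, n, hpn, hmn⟩ := Nat.exists_eq_pow_mul_and_not_dvd hm.pos.ne' p hp.ne_one
  obtain _ | k := e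
  · simp_all
  refine ⟨p, k, hp, hpodd, ?_⟩
  have hnodd : Odd n := hm.of_dvd_nat (hmn ▸ dvd_mul_left n _)
  suffices n = 1 by rw [hmn, this, mul_one]
  by_contra hn1
  have hn2 : 2 < n := by
    obtain ⟨r, rfl⟩ := hnodd
    lia
  apply h4
  rw [hmn, Nat.totient_mul (Nat.Coprime.pow_left _ ((hp.coprime_iff_not_dvd).2 hpn)),
    Nat.totient_prime_pow_succ hp]
  exact mul_dvd_mul (a := 2) (c := 2) ((hpodd.tsub_odd odd_one).two_dvd.mul_left _)
    (Nat.totient_even hn2).two_dvd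

/-- Let `g ≥ 5` be a prime and `d` an even positive integer with
`φ(d) = 2g`. Then `2g+1` is prime and `d = 4g+2`. -/
theorem stmt5 (g : ℕ) (hg : g.Prime) (hg5 : 5 ≤ g)
    (d : ℕ) (hd : 0 < d) (hdeven : Even d) (hphi : Nat.totient d = 2 * g) :
    (2 * g + 1).Prime ∧ d = 4 * g + 2 := by
  have hgodd : Odd g := hg.odd_of_ne_two (by lia)
  obtain ⟨m, rfl⟩ := hdeven.two_dvd
  rcases Nat.even_or_odd m with hm | hm
  · rw [Nat.totient_two_mul_of_even hm] at hphi
    have hmg : m.totient = g := by lia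
    have hm12 := Nat.odd_totient_iff.1 (hmg ▸ hgodd)
    have := Nat.totient_eq_one_iff.2 hm12
    lia
  rw [Nat.totient_two_mul_of_odd hm] at hphi
  have hm1 : m ≠ 1 := by
    rintro rfl
    simp at hphi
    lia
  obtain ⟨p, k, hp, hpodd, rfl⟩ := hm.exists_eq_prime_pow_of_not_four_dvd_totient hm1 (by
    obtain ⟨r, rfl⟩ := hgodd
    lia)
  rw [Nat.totient_prime_pow_succ hp] at hphi
  have hp1 := hp.one_lt
  obtain _ | k := k
  · have hpg : p = 2 * g + 1 := by
      simp at hphi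
      lia
    subst hpg
    exact ⟨hp, by ring⟩
  · have hpg : p = g := by
      have hdvd : p ∣ 2 * g := hphi ▸ (dvd_pow_self p k.succ_ne_zero).mul_right _
      exact (Nat.prime_dvd_prime_iff_eq hp hg).1
        ((Nat.coprime_two_right.2 hpodd).dvd_of_dvd_mul_left hdvd)
    subst hpg
    have h2 : p ^ k * (p - 1) = 2 :=
      Nat.eq_of_mul_eq_mul_left hp.pos (by rw [← mul_assoc, ← pow_succ', hphi, mul_comm])
    have := Nat.le_of_dvd two_pos (Dvd.intro_left _ h2)
    lia
end
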